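/- arXiv:1304.6589 — 2 statements merged into one kernel-verified Lean document; each statement's English description precedes it below -/
import Mathlib

section
/- Let R = R_1 × ⋯ × R_n where each R_j is a finite commutative local Frobenius ring with residue field of order q (the same prime power q for all j). Set soc(R) := {a ∈ R : a_j ∈ soc(R_j) for all j} and wt(a) := #{j : a_j ≠ 0}. Then the function ω : R → ℝ given by ω(a) = 1 − (−1/(q−1))^{wt(a)} for a ∈ soc(R) and ω(a) = 1 for a ∉ soc(R) is a normalized homogeneous weight on R. -/
/-- `ω : R → ℝ` is a normalized homogeneous weight on the finite ring `R`. -/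
def IsNormHomWeight (R : Type*) [Ring R] [Fintype R] [DecidableEq R] (ω : R → ℝ) : Prop :=
  ω 0 = 0 ∧
  (∀ x y : R, Finset.image (fun r => r * x) Finset.univ
      = Finset.image (fun r => r * y) Finset.univ → ω x = ω y) ∧
  ∀ x : R, x ≠ 0 →
    ∑ y ∈ Finset.image (fun r => r * x) Finset.univ, ω y
      = ((Finset.image (fun r => r * x) Finset.univ).card : ℝ)

open Classical in
/-- On a finite local ring: `1` at zero, `c` at nonzero socle elements, `0` off the socle. -/
noncomputable def socleIndicator (A : Type*) [CommRing A] [IsLocalRing A] (c : ℝ) (a : A) : ℝ :=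
  if a = 0 then 1
  else if ∀ x ∈ IsLocalRing.maximalIdeal A, a * x = 0 then c else 0

/-- A nonzero element of a finite local ring has a nonzero multiple in the socle. -/
theorem exists_mul_ne_zero_mem_socle {A : Type*} [CommRing A] [Finite A] [IsLocalRing A]
    {x : A} (hx : x ≠ 0) :
    ∃ r : A, r * x ≠ 0 ∧ ∀ m ∈ IsLocalRing.maximalIdeal A, r * x * m = 0 := by
  obtain ⟨r, hr, hmin⟩ := Set.exists_min_image {r : A | r * x ≠ 0}
    (fun r => (Set.range fun t : A => t * (r * x)).ncard) (Set.toFinite _)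
    ⟨1, by simpa using hx⟩
  refine ⟨r, hr, fun m hm => ?_⟩
  by_contra hne
  have hle := hmin (m * r) (by
    intro h
    exact hne (by rw [← h]; ring))
  have hsub : (Set.range fun t : A => t * (m * r * x)) ⊆ Set.range fun t : A => t * (r * x) := by
    rintro _ ⟨t, rfl⟩
    exact ⟨t * m, by ring⟩
  have heq := Set.eq_of_subset_of_ncard_le hsub hle (Set.toFinite _)
  obtain ⟨t, ht⟩ : r * x ∈ Set.range fun t : A => t * (m * r * x) := by
    rw [heq]
    exact ⟨1, one_mul _⟩
  have hu : IsUnit (1 - t * m) := by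
    by_contra h
    have h1 : t * m ∈ IsLocalRing.maximalIdeal A := Ideal.mul_mem_left _ _ hm
    have h2 := Ideal.add_mem _ ((IsLocalRing.mem_maximalIdeal _).2 h) h1
    rw [sub_add_cancel] at h2
    exact (IsLocalRing.mem_maximalIdeal _).1 h2 isUnit_one
  exact hr (hu.mul_right_eq_zero.1 (by
    simp only at ht
    linear_combination -ht))

/-- If the socle has as many elements as the residue field, it lies in every nonzero
principal ideal. -/
theorem exists_mul_eq_of_mem_socle {A : Type*} [CommRing A] [Finite A] [IsLocalRing A]
    (hcard : Nat.card {b : A // ∀ x ∈ IsLocalRing.maximalIdeal A, b * x = 0}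
      = Nat.card (A ⧸ IsLocalRing.maximalIdeal A))
    {x : A} (hx : x ≠ 0) {b : A} (hb : ∀ m ∈ IsLocalRing.maximalIdeal A, b * m = 0) :
    ∃ r : A, r * x = b := by
  obtain ⟨r, hr, hs⟩ := exists_mul_ne_zero_mem_socle hx
  let f : A ⧸ IsLocalRing.maximalIdeal A →
      {b : A // ∀ x ∈ IsLocalRing.maximalIdeal A, b * x = 0} :=
    fun z => ⟨Quotient.out z * (r * x), fun m hm => by rw [mul_assoc, hs m hm, mul_zero]⟩
  have hf : Function.Injective f := by
    intro z w hzw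
    have h : Quotient.out z * (r * x) = Quotient.out w * (r * x) := congrArg Subtype.val hzw
    have hmem : Quotient.out z - Quotient.out w ∈ IsLocalRing.maximalIdeal A := by
      rw [IsLocalRing.mem_maximalIdeal]
      intro hu
      exact hr (hu.mul_right_eq_zero.1 (by linear_combination h))
    have := Ideal.Quotient.eq.2 hmem
    simpa using this
  obtain ⟨z, hz⟩ := (hf.bijective_of_nat_card_le hcard.le).2 ⟨b, hb⟩
  exact ⟨Quotient.out z * r, by rw [mul_assoc]; exact congrArg Subtype.val hz⟩

theorem sum_socleIndicator_eq_zero {A : Type*} [CommRing A] [Fintype A] [DecidableEq A]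
    [IsLocalRing A] {q : ℕ} (hq1 : 1 < q)
    (hq : Nat.card (A ⧸ IsLocalRing.maximalIdeal A) = q)
    (hsoc : Nat.card {b : A // ∀ x ∈ IsLocalRing.maximalIdeal A, b * x = 0} = q)
    {x : A} (hx : x ≠ 0) :
    ∑ y ∈ Finset.image (fun r => r * x) Finset.univ,
      socleIndicator A (-1 / ((q : ℝ) - 1)) y = 0 := by
  classical
  set S : Finset A := Finset.univ.filter fun b => ∀ m ∈ IsLocalRing.maximalIdeal A, b * m = 0
    with hS
  have hScard : S.card = q := by
    rw [← hsoc, Nat.card_eq_fintype_card, Fintype.card_subtype]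
  have h0 : (0 : A) ∈ S := by simp [hS]
  have hsub : S ⊆ Finset.image (fun r => r * x) Finset.univ := by
    intro b hb
    obtain ⟨r, hr⟩ := exists_mul_eq_of_mem_socle (hsoc.trans hq.symm) hx
      (Finset.mem_filter.1 hb).2
    exact Finset.mem_image.2 ⟨r, Finset.mem_univ _, hr⟩
  rw [← Finset.sum_subset hsub, ← Finset.add_sum_erase _ _ h0]
  · rw [Finset.sum_congr rfl (g := fun _ => -1 / ((q : ℝ) - 1))]
    · have hq' : (q : ℝ) - 1 ≠ 0 := by
        have : (1 : ℝ) < q := by exact_mod_cast hq1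
        linarith
      rw [Finset.sum_const, Finset.card_erase_of_mem h0, hScard, nsmul_eq_mul,
        Nat.cast_sub hq1.le]
      simp only [socleIndicator, if_true, Nat.cast_one]
      field_simp
      ring
    · intro b hb
      obtain ⟨hb0, hb⟩ := Finset.mem_erase.1 hb
      rw [socleIndicator, if_neg hb0, if_pos (Finset.mem_filter.1 hb).2]
  · intro b _ hb
    have hb0 : b ≠ 0 := fun h => hb (h ▸ h0)
    rw [socleIndicator, if_neg hb0, if_neg]
    exact fun h => hb (Finset.mem_filter.2 ⟨Finset.mem_univ _, h⟩)

/-- `socleIndicator` depends only on the principal ideal generated by its argument. -/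
theorem socleIndicator_congr {A : Type*} [CommRing A] [IsLocalRing A] (c : ℝ) {x y r s : A}
    (hxy : r * y = x) (hyx : s * x = y) : socleIndicator A c x = socleIndicator A c y := by
  have h0 : x = 0 ↔ y = 0 :=
    ⟨fun h => by rw [← hyx, h, mul_zero], fun h => by rw [← hxy, h, mul_zero]⟩
  have h1 : (∀ m ∈ IsLocalRing.maximalIdeal A, x * m = 0) ↔
      ∀ m ∈ IsLocalRing.maximalIdeal A, y * m = 0 :=
    ⟨fun h m hm => by rw [← hyx, mul_assoc, h m hm, mul_zero],
      fun h m hm => by rw [← hxy, mul_assoc, h m hm, mul_zero]⟩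
  unfold socleIndicator
  congr 1
  · exact propext h0
  · congr 1
    exact propext h1

theorem prod_socleIndicator_of_mem {ι : Type*} [Fintype ι] (R : ι → Type*)
    [∀ j, CommRing (R j)] [∀ j, DecidableEq (R j)] [∀ j, IsLocalRing (R j)] (c : ℝ)
    {a : ∀ j, R j} (ha : ∀ j, ∀ x ∈ IsLocalRing.maximalIdeal (R j), a j * x = 0) :
    ∏ j, socleIndicator (R j) c (a j) = c ^ (Finset.univ.filter (fun j => a j ≠ 0)).card := by
  rw [← Finset.prod_const, Finset.prod_filter]
  refine Finset.prod_congr rfl fun j _ => ?_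
  by_cases h : a j = 0
  · simp [socleIndicator, h]
  · rw [socleIndicator, if_neg h, if_pos (ha j), if_pos h]

theorem prod_socleIndicator_of_notMem {ι : Type*} [Fintype ι] (R : ι → Type*)
    [∀ j, CommRing (R j)] [∀ j, IsLocalRing (R j)] (c : ℝ) {a : ∀ j, R j}
    (ha : ¬ ∀ j, ∀ x ∈ IsLocalRing.maximalIdeal (R j), a j * x = 0) :
    ∏ j, socleIndicator (R j) c (a j) = 0 := by
  obtain ⟨j, hj⟩ := not_forall.1 ha
  refine Finset.prod_eq_zero (Finset.mem_univ j) ?_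
  rw [socleIndicator, if_neg, if_neg hj]
  intro h
  exact hj fun x _ => by rw [h, zero_mul]

theorem image_mul_right_pi {ι : Type*} [Fintype ι] [DecidableEq ι] (R : ι → Type*)
    [∀ j, CommRing (R j)] [∀ j, Fintype (R j)] [∀ j, DecidableEq (R j)] (x : ∀ j, R j) :
    Finset.image (fun r => r * x) Finset.univ
      = Fintype.piFinset fun j => Finset.image (fun r => r * x j) Finset.univ := by
  ext y
  simp only [Finset.mem_image, Finset.mem_univ, true_and, Fintype.mem_piFinset]
  constructor
  · rintro ⟨r, rfl⟩ j
    exact ⟨r j, rfl⟩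
  · intro h
    choose r hr using h
    exact ⟨r, funext hr⟩

/-- Let `R = R_1 × ⋯ × R_n` with each `R j` a finite commutative local
Frobenius ring with residue field of order the same prime power `q`.  Then the function
`ω(a) = 1 − (−1/(q−1))^{wt a}` on the socle and `ω(a) = 1` outside the socle is a
normalized homogeneous weight on `R`. -/
theorem isNormHomWeight_prod_same_q {n : ℕ} (R : Fin n → Type*)
    [∀ j, CommRing (R j)] [∀ j, Fintype (R j)] [∀ j, DecidableEq (R j)]
    [∀ j, IsLocalRing (R j)] (q : ℕ) (hqpp : IsPrimePow q)
    (hq : ∀ j, Nat.card (R j ⧸ IsLocalRing.maximalIdeal (R j)) = q)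
    (hsoc : ∀ j, Nat.card {b : R j // ∀ x ∈ IsLocalRing.maximalIdeal (R j), b * x = 0} = q)
    (ω : (∀ j, R j) → ℝ)
    (hωsoc : ∀ a : ∀ j, R j, (∀ j, ∀ x ∈ IsLocalRing.maximalIdeal (R j), a j * x = 0) →
      ω a = 1 - (-1 / ((q : ℝ) - 1)) ^ (Finset.univ.filter (fun j => a j ≠ 0)).card)
    (hωout : ∀ a : ∀ j, R j, ¬ (∀ j, ∀ x ∈ IsLocalRing.maximalIdeal (R j), a j * x = 0) →
      ω a = 1) :
    IsNormHomWeight (∀ j, R j) ω := by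
  have hω (a : ∀ j, R j) :
      ω a = 1 - ∏ j, socleIndicator (R j) (-1 / ((q : ℝ) - 1)) (a j) := by
    by_cases ha : ∀ j, ∀ x ∈ IsLocalRing.maximalIdeal (R j), a j * x = 0
    · rw [hωsoc a ha, prod_socleIndicator_of_mem R _ ha]
    · rw [hωout a ha, prod_socleIndicator_of_notMem R _ ha, sub_zero]
  refine ⟨?_, fun x y hxy => ?_, fun x hx => ?_⟩
  · simp [hω, socleIndicator]
  · obtain ⟨r, -, hr⟩ := Finset.mem_image.1 <| hxy ▸
      Finset.mem_image.2 ⟨1, Finset.mem_univ _, one_mul x⟩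
    obtain ⟨s, -, hs⟩ := Finset.mem_image.1 <| hxy.symm ▸
      Finset.mem_image.2 ⟨1, Finset.mem_univ _, one_mul y⟩
    rw [hω, hω]
    congr 1
    exact Finset.prod_congr rfl fun j _ =>
      socleIndicator_congr _ (congrFun hr j) (congrFun hs j)
  · obtain ⟨j, hj⟩ := Function.ne_iff.1 hx
    simp only [hω, Finset.sum_sub_distrib, Finset.sum_const, nsmul_eq_mul, mul_one]
    rw [sub_eq_self, image_mul_right_pi, ← Finset.prod_univ_sum _
      (fun j b => socleIndicator (R j) (-1 / ((q : ℝ) - 1)) b)]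
    exact Finset.prod_eq_zero (Finset.mem_univ j)
      (sum_socleIndicator_eq_zero hqpp.one_lt (hq j) (hsoc j) hj)
end

section
/- Let R = ∏_{i=1}^t ∏_{j=1}^{n_i} R_{i,j}, where each R_{i,j} is a finite commutative local Frobenius ring with residue field of order q_i, and q_1, …, q_t are distinct prime powers. Then for every normalized homogeneous weight ω on R: there exists a nonzero a ∈ R with ω(a) = 0 if and only if there exists an index i ∈ {1,…,t} with q_i = 2 and n_i ≥ 2. -/
/-- A real function on a finite ring is a *homogeneous coweight* if `1` minus it is a
normalized homogeneous weight: it takes the value `1` at `0`, depends only on the principal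
left ideal generated by its argument, and sums to zero over each nonzero principal left ideal. -/
structure IsHomCoweight (R : Type*) [Ring R] [Fintype R] [DecidableEq R] (g : R → ℝ) : Prop where
  map_zero : g 0 = 1
  map_eq : ∀ x y : R, Finset.image (fun r => r * x) Finset.univ
      = Finset.image (fun r => r * y) Finset.univ → g x = g y
  sum_eq_zero : ∀ x : R, x ≠ 0 → ∑ y ∈ Finset.image (fun r => r * x) Finset.univ, g y = 0

theorem IsNormHomWeight.isHomCoweight {R : Type*} [Ring R] [Fintype R] [DecidableEq R]
    {ω : R → ℝ} (h : IsNormHomWeight R ω) : IsHomCoweight R (fun x => 1 - ω x) where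
  map_zero := by simp [h.1]
  map_eq x y hxy := by simp [h.2.1 x y hxy]
  sum_eq_zero x hx := by simp [Finset.sum_sub_distrib, h.2.2 x hx]

theorem IsHomCoweight.unique {R : Type*} [Ring R] [Fintype R] [DecidableEq R] {g h : R → ℝ}
    (hg : IsHomCoweight R g) (hh : IsHomCoweight R h) (x : R) : g x = h x := by
  induction hk : (Finset.image (fun r => r * x) Finset.univ).card using Nat.strong_induction_on
    generalizing x with
  | _ k ih =>
  by_cases hx : x = 0
  · rw [hx, hg.map_zero, hh.map_zero]
  set I : R → Finset R := fun z => Finset.image (fun r => r * z) Finset.univ with hI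
  have hsum : ∑ y ∈ I x, (g y - h y) = 0 := by
    rw [Finset.sum_sub_distrib, hg.sum_eq_zero x hx, hh.sum_eq_zero x hx, sub_zero]
  have hterm : ∀ y ∈ I x, g y - h y = if I y = I x then g x - h x else 0 := by
    intro y hy
    split_ifs with hyx
    · rw [hg.map_eq y x hyx, hh.map_eq y x hyx]
    · have hsub : I y ⊆ I x := by
        simp only [hI, Finset.mem_image, Finset.mem_univ, true_and] at hy
        obtain ⟨r, rfl⟩ := hy
        intro z hz
        simp only [hI, Finset.mem_image, Finset.mem_univ, true_and] at hz ⊢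
        obtain ⟨s, rfl⟩ := hz
        exact ⟨s * r, mul_assoc _ _ _⟩
      rw [ih _ (hk ▸ Finset.card_lt_card (hsub.ssubset_of_ne hyx)) y rfl, sub_self]
  rw [Finset.sum_congr rfl hterm, ← Finset.sum_filter, Finset.sum_const, nsmul_eq_mul] at hsum
  have hmem : x ∈ (I x).filter (fun y => I y = I x) := by
    simp only [hI, Finset.mem_filter, Finset.mem_image, Finset.mem_univ, true_and, and_true]
    exact ⟨1, one_mul x⟩
  have hpos : ((((I x).filter (fun y => I y = I x)).card : ℕ) : ℝ) ≠ 0 :=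
    Nat.cast_ne_zero.mpr (Finset.card_ne_zero_of_mem hmem)
  exact sub_eq_zero.mp ((mul_eq_zero.mp hsum).resolve_left hpos)

theorem image_mul_univ_pi {ι : Type*} [Fintype ι] [DecidableEq ι] {R : ι → Type*}
    [∀ i, Ring (R i)] [∀ i, Fintype (R i)] [∀ i, DecidableEq (R i)] (x : ∀ i, R i) :
    Finset.image (fun r => r * x) Finset.univ
      = Fintype.piFinset fun i => Finset.image (fun r => r * x i) Finset.univ := by
  ext y
  simp only [Finset.mem_image, Finset.mem_univ, true_and, Fintype.mem_piFinset]
  constructor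
  · rintro ⟨r, rfl⟩ i
    exact ⟨r i, rfl⟩
  · intro h
    choose r hr using h
    exact ⟨r, funext hr⟩

theorem IsHomCoweight.pi {ι : Type*} [Fintype ι] [DecidableEq ι] {R : ι → Type*}
    [∀ i, Ring (R i)] [∀ i, Fintype (R i)] [∀ i, DecidableEq (R i)] {g : ∀ i, R i → ℝ}
    (hg : ∀ i, IsHomCoweight (R i) (g i)) :
    IsHomCoweight (∀ i, R i) (fun a => ∏ i, g i (a i)) where
  map_zero := by simp [(hg _).map_zero]
  map_eq x y hxy := by
    refine Finset.prod_congr rfl fun i _ => (hg i).map_eq _ _ ?_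
    have key : ∀ z : ∀ i, R i, Finset.image (fun r => r * z i) Finset.univ
        = (Finset.image (fun r => r * z) Finset.univ).image (fun a => a i) := by
      intro z
      ext w
      simp only [Finset.mem_image, Finset.mem_univ, true_and, exists_exists_eq_and, Pi.mul_apply]
      constructor
      · rintro ⟨r, rfl⟩
        exact ⟨Function.update 0 i r, by simp⟩
      · rintro ⟨r, rfl⟩
        exact ⟨r i, rfl⟩
    rw [key x, key y, hxy]
  sum_eq_zero x hx := by
    obtain ⟨i, hi⟩ := Function.ne_iff.mp hx
    rw [image_mul_univ_pi, ← Finset.prod_univ_sum]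
    exact Finset.prod_eq_zero (Finset.mem_univ i) ((hg i).sum_eq_zero _ hi)

section Local

variable {R : Type*} [CommRing R] [IsLocalRing R]

/-- `b` lies in the socle of the local ring `R`. -/
def IsSocle (b : R) : Prop := ∀ x ∈ IsLocalRing.maximalIdeal R, b * x = 0

theorem IsSocle.mul_left {b : R} (hb : IsSocle b) (r : R) : IsSocle (r * b) := fun x hx => by
  rw [mul_assoc, hb x hx, mul_zero]

theorem isSocle_zero : IsSocle (0 : R) := fun _ _ => zero_mul _

theorem exists_isSocle_mul_ne_zero [Finite R] {x : R} (hx : x ≠ 0) :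
    ∃ r : R, IsSocle (r * x) ∧ r * x ≠ 0 := by
  obtain ⟨y, ⟨hy0, s, rfl⟩, hmin⟩ := WellFounded.has_min
    (InvImage.wf (fun y : R => Ideal.span {y}) (wellFounded_lt (α := Ideal R)))
    {y | y ≠ 0 ∧ ∃ r, r * x = y} ⟨x, hx, 1, one_mul x⟩
  refine ⟨s, fun m hm => ?_, hy0⟩
  by_contra hne
  have hnot := hmin (s * x * m) ⟨hne, m * s, by ring⟩
  have hle : Ideal.span {s * x * m} ≤ Ideal.span {s * x} :=
    Ideal.span_singleton_le_span_singleton.mpr (Dvd.intro _ rfl)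
  have heq : Ideal.span {s * x * m} = Ideal.span {s * x} := by
    by_contra h
    exact hnot (lt_of_le_of_ne hle h)
  obtain ⟨c, hc⟩ := Ideal.span_singleton_le_span_singleton.mp heq.ge
  have hunit : IsUnit (1 - m * c) := by
    refine (IsLocalRing.isUnit_or_isUnit_one_sub_self (m * c)).resolve_left fun h => ?_
    exact (IsLocalRing.mem_maximalIdeal _).mp (Ideal.mul_mem_right c _ hm) h
  refine hy0 (hunit.mul_left_eq_zero.mp ?_)
  linear_combination hc

theorem IsSocle.exists_mul_eq [Finite R]
    (hcard : Nat.card {b : R // IsSocle b} = Nat.card (R ⧸ IsLocalRing.maximalIdeal R))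
    {s : R} (hs : IsSocle s) (hs0 : s ≠ 0) {b : R} (hb : IsSocle b) : ∃ r, r * s = b := by
  let f : R ⧸ IsLocalRing.maximalIdeal R → {b : R // IsSocle b} :=
    Quotient.lift (fun r => ⟨r * s, hs.mul_left r⟩) (by
      intro r r' h
      have h' : r - r' ∈ IsLocalRing.maximalIdeal R := (Submodule.quotientRel_def _).mp h
      refine Subtype.ext ?_
      have := hs _ h'
      change r * s = r' * s
      linear_combination this)
  have hf : Function.Injective f := by
    intro u v
    obtain ⟨r, rfl⟩ := Ideal.Quotient.mk_surjective u
    obtain ⟨r', rfl⟩ := Ideal.Quotient.mk_surjective v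
    intro h
    have h' : r * s = r' * s := congrArg Subtype.val h
    rw [Ideal.Quotient.eq, IsLocalRing.mem_maximalIdeal]
    intro hu
    refine hs0 (hu.mul_right_eq_zero.mp ?_)
    linear_combination h'
  obtain ⟨u, hu⟩ := (hf.bijective_of_nat_card_le hcard.le).2 ⟨b, hb⟩
  obtain ⟨r, rfl⟩ := Ideal.Quotient.mk_surjective u
  exact ⟨r, congrArg Subtype.val hu⟩

open scoped Classical in
/-- The homogeneous coweight of a finite local Frobenius ring with residue field of order `q`. -/
noncomputable def localCoweight (q : ℕ) (b : R) : ℝ :=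
  if b = 0 then 1 else if IsSocle b then -((q : ℝ) - 1)⁻¹ else 0

theorem localCoweight_zero (q : ℕ) : localCoweight q (0 : R) = 1 := if_pos rfl

theorem localCoweight_of_isSocle {q : ℕ} {b : R} (hb0 : b ≠ 0) (hb : IsSocle b) :
    localCoweight q b = -((q : ℝ) - 1)⁻¹ := by
  rw [localCoweight, if_neg hb0, if_pos hb]

theorem abs_localCoweight_le_one {q : ℕ} (hq : 2 ≤ q) (b : R) : |localCoweight q b| ≤ 1 := by
  have h2 : (2 : ℝ) ≤ q := by exact_mod_cast hq
  unfold localCoweight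
  split_ifs
  · simp
  · rw [abs_neg, abs_of_nonneg (by rw [inv_nonneg]; linarith)]
    exact inv_le_one_of_one_le₀ (by linarith)
  · simp

theorem eq_two_of_abs_localCoweight_eq_one {q : ℕ} (hq : 2 ≤ q) {b : R} (hb0 : b ≠ 0)
    (h : |localCoweight q b| = 1) : q = 2 ∧ localCoweight q b = -1 := by
  have h2 : (2 : ℝ) ≤ q := by exact_mod_cast hq
  unfold localCoweight at h ⊢
  rw [if_neg hb0] at h ⊢
  split_ifs at h ⊢
  · rw [abs_neg, abs_of_nonneg (by rw [inv_nonneg]; linarith), inv_eq_one] at h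
    refine ⟨?_, by rw [h]; norm_num⟩
    have : (q : ℝ) = 2 := by linarith
    exact_mod_cast this
  · simp at h

theorem isHomCoweight_localCoweight [Fintype R] [DecidableEq R] {q : ℕ} (hq : 2 ≤ q)
    (hres : Nat.card (R ⧸ IsLocalRing.maximalIdeal R) = q)
    (hsoc : Nat.card {b : R // IsSocle b} = q) : IsHomCoweight R (localCoweight q) where
  map_zero := localCoweight_zero q
  map_eq x y hxy := by
    have hx : x ∈ Finset.image (fun r => r * y) Finset.univ :=
      hxy ▸ Finset.mem_image.mpr ⟨1, Finset.mem_univ _, one_mul x⟩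
    have hy : y ∈ Finset.image (fun r => r * x) Finset.univ :=
      hxy ▸ Finset.mem_image.mpr ⟨1, Finset.mem_univ _, one_mul y⟩
    simp only [Finset.mem_image, Finset.mem_univ, true_and] at hx hy
    obtain ⟨r, hr⟩ := hx
    obtain ⟨s, hs⟩ := hy
    have h0 : x = 0 ↔ y = 0 :=
      ⟨fun h => by rw [← hs, h, mul_zero], fun h => by rw [← hr, h, mul_zero]⟩
    have h1 : IsSocle x ↔ IsSocle y :=
      ⟨fun h => hs ▸ h.mul_left s, fun h => hr ▸ h.mul_left r⟩
    unfold localCoweight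
    split_ifs <;> tauto
  sum_eq_zero x hx := by
    classical
    obtain ⟨r, hr, hr0⟩ := exists_isSocle_mul_ne_zero hx
    have hsub : Finset.univ.filter (fun b : R => IsSocle b)
        ⊆ Finset.image (fun r => r * x) Finset.univ := by
      intro b hb
      obtain ⟨c, rfl⟩ := hr.exists_mul_eq (hsoc.trans hres.symm) hr0 (Finset.mem_filter.mp hb).2
      exact Finset.mem_image.mpr ⟨c * r, Finset.mem_univ _, mul_assoc _ _ _⟩
    have hcard : (Finset.univ.filter (fun b : R => IsSocle b)).card = q := by
      rw [← hsoc, Nat.card_eq_fintype_card, Fintype.card_subtype]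
    have h0 : (0 : R) ∈ Finset.univ.filter (fun b : R => IsSocle b) := by
      simp [isSocle_zero]
    have h2 : (2 : ℝ) ≤ q := by exact_mod_cast hq
    rw [← Finset.sum_subset hsub, ← Finset.add_sum_erase _ _ h0, localCoweight_zero,
      Finset.sum_congr rfl (g := fun _ => -((q : ℝ) - 1)⁻¹), Finset.sum_const,
      Finset.card_erase_of_mem h0, hcard, nsmul_eq_mul, Nat.cast_sub (by omega), Nat.cast_one,
      mul_neg, mul_inv_cancel₀ (by linarith), add_neg_cancel]
    · intro b hb
      rw [Finset.mem_erase, Finset.mem_filter] at hb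
      exact localCoweight_of_isSocle hb.1 hb.2.2
    · intro b _ hb
      have hb' : ¬ IsSocle b := by simpa using hb
      have hb0 : b ≠ 0 := fun h => hb' (h ▸ isSocle_zero)
      rw [localCoweight, if_neg hb0, if_neg hb']

end Local

theorem abs_eq_one_of_abs_prod_eq_one {ι : Type*} [Fintype ι] {f : ι → ℝ}
    (hf : ∀ i, |f i| ≤ 1) (h : |∏ i, f i| = 1) (i : ι) : |f i| = 1 := by
  classical
  refine le_antisymm (hf i) ?_
  rw [← h, ← Finset.mul_prod_erase _ _ (Finset.mem_univ i), abs_mul, Finset.abs_prod]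
  exact mul_le_of_le_one_right (abs_nonneg _)
    (Finset.prod_le_one (fun _ _ => abs_nonneg _) fun j _ => hf j)

/-- For `R = ∏_{i,j} R_{i,j}` a product of finite commutative local Frobenius
rings with residue fields of distinct prime power orders `q i`, and `ω` a normalized
homogeneous weight on `R`: there exists a nonzero `a` with `ω a = 0` iff some index `i`
has `q i = 2` and `n i ≥ 2`. -/
theorem normHomWeight_zero_iff {t : ℕ} {n : Fin t → ℕ}
    (R : (i : Fin t) → Fin (n i) → Type*)
    [∀ i j, CommRing (R i j)] [∀ i j, Fintype (R i j)] [∀ i j, DecidableEq (R i j)]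
    [∀ i j, IsLocalRing (R i j)]
    (q : Fin t → ℕ) (hqpp : ∀ i, IsPrimePow (q i)) (hqdist : Function.Injective q)
    (hq : ∀ i j, Nat.card (R i j ⧸ IsLocalRing.maximalIdeal (R i j)) = q i)
    (hsoc : ∀ i j,
      Nat.card {b : R i j // ∀ x ∈ IsLocalRing.maximalIdeal (R i j), b * x = 0} = q i)
    (ω : (∀ i, ∀ j, R i j) → ℝ) (hω : IsNormHomWeight (∀ i, ∀ j, R i j) ω) :
    (∃ a : ∀ i, ∀ j, R i j, a ≠ 0 ∧ ω a = 0) ↔ ∃ i, q i = 2 ∧ 2 ≤ n i := by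
  have hq2 : ∀ i, 2 ≤ q i := fun i => (hqpp i).two_le
  have hloc : ∀ i j, IsHomCoweight (R i j) (localCoweight (q i)) := fun i j =>
    isHomCoweight_localCoweight (hq2 i) (hq i j) (hsoc i j)
  have hval : ∀ a : ∀ i, ∀ j, R i j, 1 - ω a = ∏ i, ∏ j, localCoweight (q i) (a i j) :=
    hω.isHomCoweight.unique (IsHomCoweight.pi fun i => IsHomCoweight.pi (hloc i))
  constructor
  · rintro ⟨a, ha, ha0⟩
    have hprod := hval a
    rw [ha0, sub_zero] at hprod
    have hin : ∀ i, |∏ j, localCoweight (q i) (a i j)| ≤ 1 := fun i => by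
      rw [Finset.abs_prod]
      exact Finset.prod_le_one (fun _ _ => abs_nonneg _)
        fun j _ => abs_localCoweight_le_one (hq2 i) _
    have habs : ∀ i j, |localCoweight (q i) (a i j)| = 1 := fun i =>
      abs_eq_one_of_abs_prod_eq_one (fun j => abs_localCoweight_le_one (hq2 i) _)
        (abs_eq_one_of_abs_prod_eq_one hin (by rw [← hprod, abs_one]) i)
    obtain ⟨i, hi⟩ := Function.ne_iff.mp ha
    obtain ⟨j, hj⟩ := Function.ne_iff.mp hi
    obtain ⟨hqi, hneg⟩ := eq_two_of_abs_localCoweight_eq_one (hq2 i) hj (habs i j)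
    refine ⟨i, hqi, ?_⟩
    by_contra hn
    rw [Finset.prod_eq_single i, Finset.prod_eq_single j, hneg] at hprod
    · norm_num at hprod
    · intro j' _ hne
      have := j.isLt
      have := j'.isLt
      exact absurd (Fin.ext (by omega)) hne
    · simp
    · intro i' _ hne
      refine Finset.prod_eq_one fun j' _ => ?_
      have hz : a i' j' = 0 := by
        by_contra hz
        have h2 := (eq_two_of_abs_localCoweight_eq_one (hq2 i') hz (habs i' j')).1
        exact hne (hqdist (h2.trans hqi.symm))
      rw [hz, localCoweight_zero]
    · simp
  · rintro ⟨i, hqi, hn⟩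
    choose r hr hr0 using fun j => exists_isSocle_mul_ne_zero (one_ne_zero (α := R i j))
    have hs : ∀ j, localCoweight (q i) (r j * 1) = -1 := fun j => by
      rw [localCoweight_of_isSocle (hr0 j) (hr j), hqi]
      norm_num
    let j₀ : Fin (n i) := ⟨0, by omega⟩
    let j₁ : Fin (n i) := ⟨1, by omega⟩
    have hj : j₀ ≠ j₁ := by simp [j₀, j₁]
    let b : ∀ j, R i j := fun j => if j = j₀ ∨ j = j₁ then r j * 1 else 0
    refine ⟨Function.update 0 i b, ?_, ?_⟩
    · intro h
      have h' := congrFun (congrFun h i) j₀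
      rw [Function.update_self] at h'
      exact hr0 j₀ (by simpa [b] using h')
    · have hprod := hval (Function.update 0 i b)
      rw [Finset.prod_eq_single i, Function.update_self, Finset.prod_eq_mul j₀ j₁ hj] at hprod
      · have h₀ : b j₀ = r j₀ * 1 := if_pos (Or.inl rfl)
        have h₁ : b j₁ = r j₁ * 1 := if_pos (Or.inr rfl)
        rw [h₀, h₁, hs, hs] at hprod
        linarith
      · rintro j _ ⟨h₀, h₁⟩
        rw [show b j = 0 from if_neg (by tauto), localCoweight_zero]
      · simp
      · simp
      · intro i' _ hne
        refine Finset.prod_eq_one fun j' _ => ?_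
        rw [Function.update_of_ne hne]
        exact localCoweight_zero _
      · simp
end
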